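/- arXiv:0907.2566 — 2 statements merged into one kernel-verified Lean document; each statement's English description precedes it below -/
import Mathlib

section
/- In any 2-crossed module of groups (L, E, G, δ, ∂, ▷, {,}), for all e, f ∈ E one has {e, f}⁻¹ = e ▷′ {e⁻¹, ∂(e) ▷ f}. -/
/-- A 2-crossed module of groups `(L, E, G, δ, ∂, ▷, {,})`.
`dl` is δ : L → E, `de` is ∂ : E → G, `actL`/`actE` are the left actions of `G`
on `L` and `E` by group automorphisms, and `pl` is the Peiffer lifting. -/
structure TwoCrossedModule (L E G : Type*) [Group L] [Group E] [Group G] where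
  /-- δ : L → E -/
  dl : L →* E
  /-- ∂ : E → G -/
  de : E →* G
  /-- the action of G on L by automorphisms -/
  actL : G →* MulAut L
  /-- the action of G on E by automorphisms -/
  actE : G →* MulAut E
  /-- the Peiffer lifting {,} : E × E → L -/
  pl : E → E → L
  comp_triv : ∀ l : L, de (dl l) = 1
  dl_equiv : ∀ (a : G) (l : L), dl (actL a l) = actE a (dl l)
  de_equiv : ∀ (a : G) (e : E), de (actE a e) = a * de e * a⁻¹
  pl_equiv : ∀ (a : G) (e f : E), actL a (pl e f) = pl (actE a e) (actE a f)
  ax_i : ∀ e f : E, dl (pl e f) = e * f * e⁻¹ * actE (de e) f⁻¹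
  ax_ii : ∀ l k : L, pl (dl l) (dl k) = l * k * l⁻¹ * k⁻¹
  ax_iii : ∀ e f g : E, pl (e * f) g = pl e (f * g * f⁻¹) * actL (de e) (pl f g)
  ax_iv : ∀ e f g : E, pl e (f * g) =
    pl e f * pl e g * pl (e * g * e⁻¹ * actE (de e) g⁻¹)⁻¹ (actE (de e) f)
  ax_v : ∀ (e : E) (l : L), pl (dl l) e * pl e (dl l) = l * actL (de e) l⁻¹

/-- The operation `e ▷′ l := l * {δ(l)⁻¹, e}`. -/
def TwoCrossedModule.tprime {L E G : Type*} [Group L] [Group E] [Group G]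
    (M : TwoCrossedModule L E G) (e : E) (l : L) : L :=
  l * M.pl (M.dl l)⁻¹ e

namespace TwoCrossedModule

variable {L E G : Type*} [Group L] [Group E] [Group G] (M : TwoCrossedModule L E G)

theorem pl_one_left (g : E) : M.pl 1 g = 1 := by
  have h := M.ax_iii 1 1 g
  simpa using h

theorem pl_conj_eq_inv (e g : E) :
    M.pl e (e⁻¹ * g * e) = (M.actL (M.de e) (M.pl e⁻¹ g))⁻¹ := by
  have h := M.ax_iii e e⁻¹ g
  rw [mul_inv_cancel, pl_one_left, inv_inv] at h
  exact eq_inv_of_mul_eq_one_left h.symm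

theorem tprime_mul_pl (e : E) (l : L) :
    M.tprime e l * M.pl e (M.dl l)⁻¹ = M.actL (M.de e) l := by
  have h := M.ax_v e l⁻¹
  rw [map_inv, inv_inv] at h
  rw [tprime, mul_assoc, h, mul_inv_cancel_left]

/-- The correction term in `ax_iv` vanishes when `⟨e, g⟩ = ∂(e) ▷ δ(k)`. -/
theorem pl_dl_mul (e g : E) (k : L)
    (h : e * g * e⁻¹ * M.actE (M.de e) g⁻¹ = M.actE (M.de e) (M.dl k)) :
    M.pl e (M.dl k * g) = M.pl e (M.dl k) * M.pl e g := by
  rw [M.ax_iv, h, ← M.dl_equiv, ← map_inv, M.ax_ii]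
  simp

end TwoCrossedModule

/-- For all `e, f ∈ E`, `{e, f}⁻¹ = e ▷′ {e⁻¹, ∂(e) ▷ f}`. -/
theorem pl_inv_tprime {L E G : Type*} [Group L] [Group E] [Group G]
    (M : TwoCrossedModule L E G) :
    ∀ e f : E, (M.pl e f)⁻¹ = M.tprime e (M.pl e⁻¹ (M.actE (M.de e) f)) := by
  intro e f
  set g := M.actE (M.de e) f with hg
  set l := M.pl e⁻¹ g with hl
  have hdl : M.dl l⁻¹ = f * (e⁻¹ * g * e)⁻¹ := by
    rw [map_inv, hl, M.ax_i, hg]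
    simp [mul_assoc]
  have hsplit : M.pl e f = M.pl e (M.dl l⁻¹) * M.pl e (e⁻¹ * g * e) := by
    rw [← M.pl_dl_mul, hdl, inv_mul_cancel_right]
    rw [hdl, map_mul, ← hg]
    group
  have ht := M.tprime_mul_pl e l
  rw [hsplit, M.pl_conj_eq_inv, ← hl, ← ht, map_inv]
  group
end

section
/- In any differential 2-crossed module (𝔩, 𝔢, 𝔤, δ, ∂, ▷, {,}), for all u ∈ 𝔢 and x ∈ 𝔩 one has δ(u ▷′ x) = [u, δ(x)]; hence (δ : 𝔩 → 𝔢, ▷′) is a differential crossed module. -/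
/-- A differential 2-crossed module `(𝔩, 𝔢, 𝔤, δ, ∂, ▷, {,})` of real Lie
algebras. `dl` is δ : 𝔩 → 𝔢, `pd` is ∂ : 𝔢 → 𝔤, `actL`/`actE` are the left
actions of `𝔤` on `𝔩` and `𝔢` by derivations, and `pl` is the Peiffer lifting. -/
structure DiffTwoCrossedModule (𝔩 𝔢 𝔤 : Type*)
    [LieRing 𝔩] [LieAlgebra ℝ 𝔩] [LieRing 𝔢] [LieAlgebra ℝ 𝔢]
    [LieRing 𝔤] [LieAlgebra ℝ 𝔤] where
  /-- δ : 𝔩 → 𝔢 -/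
  dl : 𝔩 →ₗ⁅ℝ⁆ 𝔢
  /-- ∂ : 𝔢 → 𝔤 -/
  pd : 𝔢 →ₗ⁅ℝ⁆ 𝔤
  /-- the action of 𝔤 on 𝔩 by derivations -/
  actL : 𝔤 →ₗ⁅ℝ⁆ LieDerivation ℝ 𝔩 𝔩
  /-- the action of 𝔤 on 𝔢 by derivations -/
  actE : 𝔤 →ₗ⁅ℝ⁆ LieDerivation ℝ 𝔢 𝔢
  /-- the Peiffer lifting {,} : 𝔢 × 𝔢 → 𝔩, a bilinear map -/
  pl : 𝔢 →ₗ[ℝ] 𝔢 →ₗ[ℝ] 𝔩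
  comp_triv : ∀ v : 𝔩, pd (dl v) = 0
  dl_equiv : ∀ (X : 𝔤) (x : 𝔩), dl (actL X x) = actE X (dl x)
  pd_equiv : ∀ (X : 𝔤) (v : 𝔢), pd (actE X v) = ⁅X, pd v⁆
  pl_equiv : ∀ (X : 𝔤) (u v : 𝔢),
    actL X (pl u v) = pl (actE X u) v + pl u (actE X v)
  ax_i : ∀ u v : 𝔢, dl (pl u v) = ⁅u, v⁆ - actE (pd u) v
  ax_ii : ∀ x y : 𝔩, pl (dl x) (dl y) = ⁅x, y⁆
  ax_iii : ∀ u v w : 𝔢, pl ⁅u, v⁆ w =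
    actL (pd u) (pl v w) + pl u ⁅v, w⁆ - actL (pd v) (pl u w) - pl v ⁅u, w⁆
  ax_iv : ∀ u v w : 𝔢, pl u ⁅v, w⁆ = pl (dl (pl u v)) w - pl (dl (pl u w)) v
  ax_v : ∀ (x : 𝔩) (v : 𝔢), pl (dl x) v + pl v (dl x) = -(actL (pd v) x)

/-- The operation `v ▷′ x := −{δ(x), v}`. -/
def DiffTwoCrossedModule.tprime {𝔩 𝔢 𝔤 : Type*}
    [LieRing 𝔩] [LieAlgebra ℝ 𝔩] [LieRing 𝔢] [LieAlgebra ℝ 𝔢]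
    [LieRing 𝔤] [LieAlgebra ℝ 𝔤] (M : DiffTwoCrossedModule 𝔩 𝔢 𝔤)
    (v : 𝔢) (x : 𝔩) : 𝔩 :=
  -(M.pl (M.dl x) v)

namespace DiffTwoCrossedModule

variable {𝔩 𝔢 𝔤 : Type*}
  [LieRing 𝔩] [LieAlgebra ℝ 𝔩] [LieRing 𝔢] [LieAlgebra ℝ 𝔢]
  [LieRing 𝔤] [LieAlgebra ℝ 𝔤] (M : DiffTwoCrossedModule 𝔩 𝔢 𝔤)

theorem dl_pl_dl (x : 𝔩) (u : 𝔢) : M.dl (M.pl (M.dl x) u) = ⁅M.dl x, u⁆ := by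
  simp [M.ax_i, M.comp_triv]

theorem pl_dl_lie (x y : 𝔩) (u : 𝔢) :
    M.pl (M.dl x) ⁅M.dl y, u⁆ = ⁅x, M.pl (M.dl y) u⁆ := by
  rw [← M.dl_pl_dl, M.ax_ii]

theorem pl_dl_bracket (x y : 𝔩) (u : 𝔢) :
    M.pl (M.dl ⁅x, y⁆) u = ⁅x, M.pl (M.dl y) u⁆ - ⁅y, M.pl (M.dl x) u⁆ := by
  rw [LieHom.map_lie, M.ax_iii, M.pl_dl_lie, M.pl_dl_lie]
  simp [M.comp_triv]

end DiffTwoCrossedModule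

/-- In any differential 2-crossed module, `δ(u ▷′ x) = [u, δ(x)]`; hence
`(δ : 𝔩 → 𝔢, ▷′)` is a differential crossed module (so `▷′` is an action by
derivations satisfying the equivariance and Peiffer conditions). -/
theorem dl_tprime_crossed_module {𝔩 𝔢 𝔤 : Type*}
    [LieRing 𝔩] [LieAlgebra ℝ 𝔩] [LieRing 𝔢] [LieAlgebra ℝ 𝔢]
    [LieRing 𝔤] [LieAlgebra ℝ 𝔤] (M : DiffTwoCrossedModule 𝔩 𝔢 𝔤) :
    (∀ (u : 𝔢) (x : 𝔩), M.dl (M.tprime u x) = ⁅u, M.dl x⁆) ∧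
    (∀ (u v : 𝔢) (x : 𝔩),
      M.tprime ⁅u, v⁆ x = M.tprime u (M.tprime v x) - M.tprime v (M.tprime u x)) ∧
    (∀ (u : 𝔢) (x y : 𝔩),
      M.tprime u ⁅x, y⁆ = ⁅M.tprime u x, y⁆ + ⁅x, M.tprime u y⁆) ∧
    (∀ x y : 𝔩, M.tprime (M.dl x) y = ⁅x, y⁆) := by
  refine ⟨fun u x => ?_, fun u v x => ?_, fun u x y => ?_, fun x y => ?_⟩ <;>
    unfold DiffTwoCrossedModule.tprime
  · rw [map_neg, M.dl_pl_dl, lie_skew]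
  · rw [M.ax_iv]
    simp only [map_neg, LinearMap.neg_apply, neg_neg]
    abel
  · rw [M.pl_dl_bracket, neg_lie, lie_skew, lie_neg]
    abel
  · rw [M.ax_ii, lie_skew]
end
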